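/- arXiv:2411.16272 — 2 statements merged into one kernel-verified Lean document; each statement's English description precedes it below -/
import Mathlib

section
/- For natural numbers n, A, B, let p(n, A, B) denote the number of partitions of n into at most A parts, each part of size at most B (the coefficient of qⁿ in the Gaussian binomial coefficient [A+B choose A]_q), with the convention that a term is 0 when the required shift exceeds n. Write T(j) = j(j−1)/2. Then for all natural numbers k, M, N, n with k ≤ M and N ≥ 1: (if T(k) ≤ n then p(n − T(k), M−k, N+k−1) else 0) + (if T(k+1) ≤ n and k+1 ≤ M then p(n − T(k+1), M−k−1, N+k) else 0) = Σ_{x=0}^{min(N, M−k)} Σ_{n₁, n₂ ≥ 0, n₁ + n₂ + T(k+x) + T(x) = n} p(n₁, k+x, M−k−x) · p(n₂, x, N−x). -/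
/-- `restrictedPartitions n A B` is the number of partitions of `n` into at most
`A` parts, each of size at most `B` (the coefficient of `qⁿ` in the Gaussian
binomial coefficient `[A+B choose A]_q`). -/
noncomputable def restrictedPartitions (n A B : ℕ) : ℕ :=
  Nat.card {π : n.Partition // Multiset.card π.parts ≤ A ∧ ∀ i ∈ π.parts, i ≤ B}

/-- The triangular number `T(j) = j(j−1)/2`. -/
def tri (j : ℕ) : ℕ := j * (j - 1) / 2

open PowerSeries

/-- The multisets of positive parts that are partitions of `n` in an `A × B` box. -/
def boxedMultisets (n A B : ℕ) : Set (Multiset ℕ) :=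
  {s | (∀ i ∈ s, 0 < i) ∧ s.sum = n ∧ Multiset.card s ≤ A ∧ ∀ i ∈ s, i ≤ B}

theorem boxedMultisets_eq_image (n A B : ℕ) :
    boxedMultisets n A B = Nat.Partition.parts ''
      {π : n.Partition | Multiset.card π.parts ≤ A ∧ ∀ i ∈ π.parts, i ≤ B} := by
  ext s
  constructor
  · rintro ⟨hpos, hsum, hcard, hle⟩
    exact ⟨⟨s, fun {i} hi => hpos i hi, hsum⟩, ⟨hcard, hle⟩, rfl⟩
  · rintro ⟨π, ⟨hcard, hle⟩, rfl⟩
    exact ⟨fun i hi => π.parts_pos hi, π.parts_sum, hcard, hle⟩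

theorem finite_boxedMultisets (n A B : ℕ) : (boxedMultisets n A B).Finite := by
  rw [boxedMultisets_eq_image]
  exact (Set.toFinite _).image _

theorem restrictedPartitions_eq_ncard (n A B : ℕ) :
    restrictedPartitions n A B = (boxedMultisets n A B).ncard := by
  rw [boxedMultisets_eq_image,
    Set.ncard_image_of_injective _ fun _ _ h => Nat.Partition.ext h]
  rfl

theorem boxedMultisets_succ_succ (n A B : ℕ) (h : B + 1 ≤ n) :
    boxedMultisets n (A + 1) (B + 1) = boxedMultisets n (A + 1) B ∪
      Multiset.cons (B + 1) '' boxedMultisets (n - (B + 1)) A (B + 1) := by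
  ext s
  constructor
  · rintro ⟨hpos, hsum, hcard, hle⟩
    by_cases hmem : B + 1 ∈ s
    · right
      obtain ⟨t, rfl⟩ := Multiset.exists_cons_of_mem hmem
      simp only [Multiset.sum_cons, Multiset.card_cons] at hsum hcard
      exact ⟨t, ⟨fun i hi => hpos i (Multiset.mem_cons_of_mem hi), by omega, by omega,
        fun i hi => hle i (Multiset.mem_cons_of_mem hi)⟩, rfl⟩
    · left
      refine ⟨hpos, hsum, hcard, fun i hi => ?_⟩
      have hne : i ≠ B + 1 := fun e => hmem (e ▸ hi)
      have := hle i hi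
      omega
  · rintro (⟨hpos, hsum, hcard, hle⟩ | ⟨t, ⟨hpos, hsum, hcard, hle⟩, rfl⟩)
    · exact ⟨hpos, hsum, hcard, fun i hi => (hle i hi).trans (Nat.le_succ B)⟩
    · refine ⟨fun i hi => ?_, ?_, ?_, fun i hi => ?_⟩
      · rcases Multiset.mem_cons.1 hi with rfl | hi
        exacts [Nat.succ_pos B, hpos i hi]
      · rw [Multiset.sum_cons]; omega
      · rw [Multiset.card_cons]; omega
      · rcases Multiset.mem_cons.1 hi with rfl | hi
        exacts [le_rfl, hle i hi]

theorem restrictedPartitions_succ_succ (n A B : ℕ) :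
    restrictedPartitions n (A + 1) (B + 1) = restrictedPartitions n (A + 1) B +
      if B + 1 ≤ n then restrictedPartitions (n - (B + 1)) A (B + 1) else 0 := by
  simp only [restrictedPartitions_eq_ncard]
  split_ifs with h
  · rw [boxedMultisets_succ_succ n A B h, Set.ncard_union_eq ?_
      (finite_boxedMultisets _ _ _) ((finite_boxedMultisets _ _ _).image _),
      Set.ncard_image_of_injective _ fun _ _ => (Multiset.cons_inj_right (B + 1)).1]
    rw [Set.disjoint_left]
    rintro _ ⟨_, _, _, hle⟩ ⟨t, _, rfl⟩
    have := hle (B + 1) (Multiset.mem_cons_self _ _)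
    omega
  · rw [add_zero]
    congr 1
    ext s
    refine ⟨fun ⟨hpos, hsum, hcard, _⟩ => ⟨hpos, hsum, hcard, fun i hi => ?_⟩,
      fun ⟨hpos, hsum, hcard, hle⟩ =>
        ⟨hpos, hsum, hcard, fun i hi => (hle i hi).trans (Nat.le_succ B)⟩⟩
    have := Multiset.le_sum_of_mem hi
    omega

theorem boxedMultisets_of_eq_zero (n A B : ℕ) (h : A = 0 ∨ B = 0) :
    boxedMultisets n A B = if n = 0 then {0} else ∅ := by
  have key : ∀ s ∈ boxedMultisets n A B, s = 0 := by
    rintro s ⟨hpos, _, hcard, hle⟩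
    rcases h with rfl | rfl
    · exact Multiset.card_eq_zero.1 (Nat.le_zero.1 hcard)
    · refine Multiset.eq_zero_of_forall_notMem fun i hi => ?_
      have := hpos i hi
      have := hle i hi
      omega
  split_ifs with hn
  · subst hn
    ext s
    refine ⟨key s, ?_⟩
    rintro rfl
    simp [boxedMultisets]
  · refine Set.eq_empty_of_forall_notMem fun s hs => hn ?_
    obtain rfl := key s hs
    exact hs.2.1.symm

/-- The Gaussian binomial `[A+B choose A]_q` as the generating function of partitions
in an `A × B` box. -/
noncomputable def gaussBox (A B : ℕ) : PowerSeries ℕ :=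
  PowerSeries.mk fun n => restrictedPartitions n A B

theorem gaussBox_eq_one (A B : ℕ) (h : A = 0 ∨ B = 0) : gaussBox A B = 1 := by
  ext n
  rw [gaussBox, coeff_mk, coeff_one, restrictedPartitions_eq_ncard,
    boxedMultisets_of_eq_zero n A B h]
  split_ifs <;> simp

@[simp]
theorem gaussBox_zero_left (B : ℕ) : gaussBox 0 B = 1 := gaussBox_eq_one 0 B (.inl rfl)

@[simp]
theorem gaussBox_zero_right (A : ℕ) : gaussBox A 0 = 1 := gaussBox_eq_one A 0 (.inr rfl)

theorem gaussBox_succ_succ (A B : ℕ) :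
    gaussBox (A + 1) (B + 1) = gaussBox (A + 1) B + X ^ (B + 1) * gaussBox A (B + 1) := by
  ext n
  simp only [gaussBox, map_add, coeff_mk, coeff_X_pow_mul']
  exact restrictedPartitions_succ_succ n A B

theorem gaussBox_succ_succ' (A B : ℕ) :
    gaussBox (A + 1) (B + 1) = gaussBox A (B + 1) + X ^ (A + 1) * gaussBox (A + 1) B := by
  induction A generalizing B with
  | zero =>
    induction B with
    | zero => simp [gaussBox_succ_succ]
    | succ B ihB =>
      calc gaussBox 1 (B + 2)
          = gaussBox 1 (B + 1) + X ^ (B + 2) * gaussBox 0 (B + 2) := gaussBox_succ_succ 0 (B + 1)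
        _ = gaussBox 0 (B + 1) + X ^ 1 * gaussBox 1 B + X ^ (B + 2) * gaussBox 0 (B + 2) := by
          rw [← ihB]
        _ = gaussBox 0 (B + 2) + X ^ 1 * (gaussBox 1 B + X ^ (B + 1) * gaussBox 0 (B + 1)) := by
          simp only [gaussBox_zero_left]
          ring
        _ = gaussBox 0 (B + 2) + X ^ 1 * gaussBox 1 (B + 1) := by
          rw [← gaussBox_succ_succ 0 B]
  | succ A ihA =>
    induction B with
    | zero =>
      calc gaussBox (A + 2) 1
          = gaussBox (A + 2) 0 + X ^ 1 * gaussBox (A + 1) 1 := gaussBox_succ_succ (A + 1) 0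
        _ = gaussBox (A + 2) 0 + X ^ 1 * (gaussBox A 1 + X ^ (A + 1) * gaussBox (A + 1) 0) := by
          rw [← ihA 0]
        _ = gaussBox (A + 1) 0 + X ^ 1 * gaussBox A 1 + X ^ (A + 2) * gaussBox (A + 2) 0 := by
          simp only [gaussBox_zero_right]
          ring
        _ = gaussBox (A + 1) 1 + X ^ (A + 2) * gaussBox (A + 2) 0 := by
          rw [← gaussBox_succ_succ A 0]
    | succ B ihB =>
      calc gaussBox (A + 2) (B + 2)
          = gaussBox (A + 2) (B + 1) + X ^ (B + 2) * gaussBox (A + 1) (B + 2) :=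
            gaussBox_succ_succ (A + 1) (B + 1)
        _ = (gaussBox (A + 1) (B + 1) + X ^ (A + 2) * gaussBox (A + 2) B) +
              X ^ (B + 2) * (gaussBox A (B + 2) + X ^ (A + 1) * gaussBox (A + 1) (B + 1)) := by
          rw [← ihB, ← ihA (B + 1)]
        _ = (gaussBox (A + 1) (B + 1) + X ^ (B + 2) * gaussBox A (B + 2)) +
              X ^ (A + 2) * (gaussBox (A + 2) B + X ^ (B + 1) * gaussBox (A + 1) (B + 1)) := by
          ring
        _ = gaussBox (A + 1) (B + 2) + X ^ (A + 2) * gaussBox (A + 2) (B + 1) := by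
          rw [← gaussBox_succ_succ A (B + 1), ← gaussBox_succ_succ (A + 1) B]

theorem gaussBox_comm (A B : ℕ) : gaussBox A B = gaussBox B A := by
  induction A generalizing B with
  | zero => simp
  | succ A ihA =>
    induction B with
    | zero => simp
    | succ B ihB => rw [gaussBox_succ_succ, gaussBox_succ_succ', ihB, ihA]

theorem tri_succ (j : ℕ) : tri (j + 1) = tri j + j := by
  simp only [tri, Nat.triangle_succ]

/-- `q ^ T(j) [M choose j]_q`, the coefficient of `z ^ j` in `∏ i < M, (1 + z q ^ i)`. -/
noncomputable def shiftedGauss (M j : ℕ) : PowerSeries ℕ :=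
  if j ≤ M then X ^ tri j * gaussBox j (M - j) else 0

theorem shiftedGauss_zero_right (M : ℕ) : shiftedGauss M 0 = 1 := by
  simp [shiftedGauss, tri]

theorem shiftedGauss_of_lt {M j : ℕ} (h : M < j) : shiftedGauss M j = 0 :=
  if_neg h.not_ge

theorem shiftedGauss_succ_succ (M j : ℕ) :
    shiftedGauss (M + 1) (j + 1) = shiftedGauss M (j + 1) + X ^ M * shiftedGauss M j := by
  rcases lt_trichotomy j M with h | rfl | h
  · obtain ⟨b, rfl⟩ := Nat.exists_eq_add_of_lt h
    have h₁ : j + b + 1 + 1 - (j + 1) = b + 1 := by omega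
    have h₂ : j + b + 1 - (j + 1) = b := by omega
    have h₃ : j + b + 1 - j = b + 1 := by omega
    rw [shiftedGauss, shiftedGauss, shiftedGauss, if_pos (by omega), if_pos (by omega),
      if_pos (by omega), h₁, h₂, h₃, gaussBox_succ_succ, tri_succ]
    ring
  · simp [shiftedGauss, tri_succ, pow_add, mul_comm]
  · rw [shiftedGauss_of_lt h, shiftedGauss_of_lt (by omega), shiftedGauss_of_lt (by omega)]
    simp

/-- `q ^ T(k) [M+N choose M-k]_q`. -/
noncomputable def crossGauss (M N k : ℕ) : PowerSeries ℕ :=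
  if k ≤ M then X ^ tri k * gaussBox (M - k) (N + k) else 0

theorem crossGauss_zero_middle (M k : ℕ) : crossGauss M 0 k = shiftedGauss M k := by
  rw [crossGauss, shiftedGauss, zero_add, gaussBox_comm]

theorem crossGauss_succ (M N k : ℕ) :
    crossGauss M (N + 1) k = crossGauss M N k + X ^ (N + 1) * crossGauss M N (k + 1) := by
  rcases lt_trichotomy k M with h | rfl | h
  · obtain ⟨b, rfl⟩ := Nat.exists_eq_add_of_lt h
    have h₁ : k + b + 1 - k = b + 1 := by omega
    have h₂ : k + b + 1 - (k + 1) = b := by omega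
    rw [crossGauss, crossGauss, crossGauss, if_pos (by omega), if_pos (by omega),
      if_pos (by omega), h₁, h₂, show N + 1 + k = N + k + 1 by ring, gaussBox_succ_succ, tri_succ,
      show N + (k + 1) = N + k + 1 by ring]
    ring
  · simp [crossGauss]
  · simp [crossGauss, h.not_ge, show ¬ k + 1 ≤ M by omega]

theorem sum_shiftedGauss_mul_shiftedGauss_succ (M N k : ℕ) :
    ∑ x ∈ Finset.range (N + 2), shiftedGauss M (k + x) * shiftedGauss (N + 1) x =
      ∑ x ∈ Finset.range (N + 1), shiftedGauss M (k + x) * shiftedGauss N x +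
        X ^ N * ∑ x ∈ Finset.range (N + 1), shiftedGauss M (k + 1 + x) * shiftedGauss N x := by
  have h : ∑ x ∈ Finset.range (N + 1), shiftedGauss M (k + x) * shiftedGauss N x =
      ∑ x ∈ Finset.range (N + 2), shiftedGauss M (k + x) * shiftedGauss N x := by
    rw [Finset.sum_range_succ _ (N + 1), shiftedGauss_of_lt (Nat.lt_succ_self N), mul_zero,
      add_zero]
  rw [h, Finset.sum_range_succ' _ (N + 1), Finset.sum_range_succ' _ (N + 1), Finset.mul_sum,
    add_right_comm, ← Finset.sum_add_distrib, shiftedGauss_zero_right, shiftedGauss_zero_right]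
  congr 1
  refine Finset.sum_congr rfl fun x _ => ?_
  rw [shiftedGauss_succ_succ, show k + 1 + x = k + (x + 1) by ring]
  ring

theorem sum_shiftedGauss_mul_shiftedGauss (M N k : ℕ) :
    ∑ x ∈ Finset.range (N + 2), shiftedGauss M (k + x) * shiftedGauss (N + 1) x =
      crossGauss M N k + crossGauss M N (k + 1) := by
  induction N generalizing k with
  | zero =>
    simp [sum_shiftedGauss_mul_shiftedGauss_succ, shiftedGauss_zero_right,
      crossGauss_zero_middle]
  | succ N ih =>
    rw [sum_shiftedGauss_mul_shiftedGauss_succ, ih, ih, crossGauss_succ, crossGauss_succ]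
    ring

theorem coeff_X_pow_mul_gaussBox_mul_gaussBox (n s t A B C D : ℕ) :
    coeff n (X ^ s * gaussBox A B * (X ^ t * gaussBox C D)) =
      ∑ n₁ ∈ Finset.range (n + 1), ∑ n₂ ∈ Finset.range (n + 1),
        if n₁ + n₂ + s + t = n then
          restrictedPartitions n₁ A B * restrictedPartitions n₂ C D else 0 := by
  rw [mul_mul_mul_comm, ← pow_add, coeff_X_pow_mul', ← Finset.sum_product', ← Finset.sum_filter]
  split_ifs with h
  · rw [coeff_mul]
    simp only [gaussBox, coeff_mk]
    refine Finset.sum_congr (Finset.ext fun ⟨a, b⟩ => ?_) fun _ _ => rfl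
    simp only [Finset.HasAntidiagonal.mem_antidiagonal, Finset.mem_filter,
      Finset.mem_product, Finset.mem_range]
    omega
  · refine (Finset.sum_eq_zero fun p hp => ?_).symm
    have := (Finset.mem_filter.1 hp).2
    omega

/-- The second character identity (coefficient-wise `q`-Pascal plus twice
`q`-Vandermonde): `q^{T(k)} [M+N−1 choose M−k]_q + q^{T(k+1)} [M+N−1 choose
M−k−1]_q = Σ_x q^{T(k+x)} [M choose k+x]_q · q^{T(x)} [N choose x]_q`. -/
theorem character_identity_two (k M N n : ℕ) (hk : k ≤ M) (hN : 1 ≤ N) :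
    ((if tri k ≤ n then restrictedPartitions (n - tri k) (M - k) (N + k - 1) else 0) +
      (if tri (k + 1) ≤ n ∧ k + 1 ≤ M then
        restrictedPartitions (n - tri (k + 1)) (M - k - 1) (N + k) else 0)) =
      ∑ x ∈ Finset.range (min N (M - k) + 1),
        ∑ n₁ ∈ Finset.range (n + 1),
          ∑ n₂ ∈ Finset.range (n + 1),
            if n₁ + n₂ + tri (k + x) + tri x = n then
              restrictedPartitions n₁ (k + x) (M - k - x) *
                restrictedPartitions n₂ x (N - x)
            else 0 := by
  obtain ⟨N, rfl⟩ := Nat.exists_eq_add_of_le' hN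
  have key := congrArg (coeff n) (sum_shiftedGauss_mul_shiftedGauss M N k)
  have hsub : Finset.range (min (N + 1) (M - k) + 1) ⊆ Finset.range (N + 2) :=
    Finset.range_subset_range.2 (by omega)
  rw [← Finset.sum_subset hsub fun x _ hx => ?_, map_sum] at key
  · refine Eq.trans ?_ (key.symm.trans (Finset.sum_congr rfl fun x hx => ?_))
    · rw [map_add, crossGauss, crossGauss, if_pos hk, coeff_X_pow_mul',
        show N + 1 + k - 1 = N + k by omega, show N + 1 + k = N + (k + 1) by ring]
      congr 1
      · simp [gaussBox]
      · by_cases h : k + 1 ≤ M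
        · simp [h, gaussBox, coeff_X_pow_mul', Nat.sub_sub]
        · simp [h]
    · have hx' := Finset.mem_range.1 hx
      rw [shiftedGauss, shiftedGauss, if_pos (by omega), if_pos (by omega),
        coeff_X_pow_mul_gaussBox_mul_gaussBox, Nat.sub_sub]
  · rw [Finset.mem_range] at hx
    rcases Nat.lt_or_ge M (k + x) with h | h
    · rw [shiftedGauss_of_lt h, zero_mul]
    · rw [shiftedGauss_of_lt (M := N + 1) (by omega), mul_zero]
end

section
/- Let ξ, ε, τ be real numbers with ξ > 0. For x > 0 define B(x) = −τ · exp(2ξ/x) · x^(−2ε) · ∫_{t ∈ (0, x)} exp(−2ξ/t) · t^(2ε−1) dt. Then B(x) tends to 0 as x tends to 0 from the right, i.e. Tendsto B (𝓝[>] 0) (𝓝 0). -/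
open Real MeasureTheory Filter Topology

/-- The variation-of-constants solution
`B(x) = −τ e^{2ξ/x} x^{−2ε} ∫₀ˣ e^{−2ξ/t} t^{2ε−1} dt`. -/
noncomputable def Bsol (ξ ε τ : ℝ) (x : ℝ) : ℝ :=
  -τ * Real.exp (2 * ξ / x) * x ^ (-2 * ε) *
    ∫ t in Set.Ioo (0 : ℝ) x, Real.exp (-2 * ξ / t) * t ^ (2 * ε - 1)

/-- The factor `e^{-c/t}` beats every real power of `t` as `t → 0⁺`. -/
lemma tendsto_exp_neg_div_mul_rpow_nhdsGT_zero (c p : ℝ) (hc : 0 < c) :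
    Tendsto (fun t : ℝ => Real.exp (-c / t) * t ^ p) (𝓝[>] 0) (𝓝 0) := by
  have h := (tendsto_rpow_mul_exp_neg_mul_atTop_nhds_zero (-p) c hc).comp
    tendsto_inv_nhdsGT_zero
  refine h.congr' ?_
  filter_upwards [self_mem_nhdsWithin] with t ht
  have ht : 0 < t := ht
  simp only [Function.comp, Real.inv_rpow ht.le, Real.rpow_neg ht.le, inv_inv]
  rw [mul_comm, div_eq_mul_inv]

/-- Derivative of `e^{-2ξ/t} t^{2ε+1}`. -/
lemma hasDerivAt_exp_neg_div_mul_rpow (ξ ε t : ℝ) (ht : 0 < t) :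
    HasDerivAt (fun t : ℝ => Real.exp (-(2 * ξ) / t) * t ^ (2 * ε + 1))
      ((2 * ξ + (2 * ε + 1) * t) * (Real.exp (-2 * ξ / t) * t ^ (2 * ε - 1))) t := by
  have h1 : HasDerivAt (fun t : ℝ => -(2 * ξ) / t) (2 * ξ / t ^ 2) t := by
    have h := (hasDerivAt_inv ht.ne').const_mul (-(2 * ξ))
    refine h.congr_deriv ?_
    field_simp
  have h2 := h1.exp.mul (Real.hasDerivAt_rpow_const (p := 2 * ε + 1) (Or.inl ht.ne'))
  refine h2.congr_deriv ?_
  have e1 : t ^ (2 * ε + 1) = t ^ (2 * ε - 1) * t ^ 2 := by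
    rw [← Real.rpow_natCast, ← Real.rpow_add ht]
    congr 1
    push_cast
    ring
  have e2 : t ^ (2 * ε + 1 - 1) = t ^ (2 * ε - 1) * t := by
    rw [← Real.rpow_add_one ht.ne']
    congr 1
    ring
  rw [e1, e2, neg_mul]
  field_simp

/-- If `2ξ + (2ε+1)t ≥ ξ` on `(0, x)`, the integral in `Bsol` is at most
`ξ⁻¹ e^{-2ξ/x} x^{2ε+1}`. -/
lemma mul_setIntegral_exp_neg_div_mul_rpow_le (ξ ε x : ℝ) (hξ : 0 < ξ) (hx : 0 < x)
    (hsmall : ∀ t ∈ Set.Ioo 0 x, ξ ≤ 2 * ξ + (2 * ε + 1) * t) :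
    ξ * ∫ t in Set.Ioo (0 : ℝ) x, Real.exp (-2 * ξ / t) * t ^ (2 * ε - 1) ≤
      Real.exp (-(2 * ξ) / x) * x ^ (2 * ε + 1) := by
  by_cases hint : IntegrableOn (fun t : ℝ => Real.exp (-2 * ξ / t) * t ^ (2 * ε - 1))
      (Set.Ioo 0 x)
  · set G : ℝ → ℝ := Function.update
      (fun t : ℝ => Real.exp (-(2 * ξ) / t) * t ^ (2 * ε + 1)) 0 0 with hG
    have hGt : ∀ t, 0 < t → HasDerivAt G
        ((2 * ξ + (2 * ε + 1) * t) * (Real.exp (-2 * ξ / t) * t ^ (2 * ε - 1))) t := by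
      intro t ht
      refine (hasDerivAt_exp_neg_div_mul_rpow ξ ε t ht).congr_of_eventuallyEq ?_
      filter_upwards [lt_mem_nhds ht] with s hs
      exact Function.update_of_ne hs.ne' _ _
    have hcont : ContinuousOn G (Set.Icc 0 x) := by
      intro t ht
      rcases ht.1.eq_or_lt with rfl | h0
      · rw [hG, continuousWithinAt_update_same]
        refine (tendsto_exp_neg_div_mul_rpow_nhdsGT_zero (2 * ξ) (2 * ε + 1)
          (by positivity)).mono_left (nhdsWithin_mono _ ?_)
        intro s hs
        exact lt_of_le_of_ne hs.1.1 (Ne.symm hs.2)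
      · exact (hGt t h0).continuousAt.continuousWithinAt
    have key := intervalIntegral.integral_le_sub_of_hasDeriv_right_of_le
      (φ := fun t => ξ * (Real.exp (-2 * ξ / t) * t ^ (2 * ε - 1))) hx.le hcont
      (fun t ht => (hGt t ht.1).hasDerivWithinAt)
      ((integrableOn_Icc_iff_integrableOn_Ioo enorm_ne_top enorm_ne_top).2 (hint.const_mul ξ))
      (fun t ht => mul_le_mul_of_nonneg_right (hsmall t ht)
        (mul_nonneg (Real.exp_pos _).le (Real.rpow_nonneg ht.1.le _)))
    rw [intervalIntegral.integral_const_mul, intervalIntegral.integral_of_le hx.le,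
      integral_Ioc_eq_integral_Ioo] at key
    simpa [hG, hx.ne'] using key
  · rw [integral_undef hint, mul_zero]
    positivity

/-- For `ξ > 0`, the solution `B` tends to `0` as `x → 0⁺`. -/
theorem Bsol_tendsto_zero (ξ ε τ : ℝ) (hξ : 0 < ξ) :
    Tendsto (Bsol ξ ε τ) (𝓝[>] (0 : ℝ)) (𝓝 0) := by
  have hlim : Tendsto (fun x : ℝ => |τ| / ξ * x) (𝓝[>] 0) (𝓝 0) := by
    have h : Tendsto (fun x : ℝ => |τ| / ξ * x) (𝓝 0) (𝓝 (|τ| / ξ * 0)) :=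
      tendsto_id.const_mul _
    rw [mul_zero] at h
    exact h.mono_left nhdsWithin_le_nhds
  refine squeeze_zero_norm' ?_ hlim
  have hδ : 0 < ξ / (|2 * ε + 1| + 1) := by positivity
  filter_upwards [Ioo_mem_nhdsGT hδ] with x hx
  have hx0 : 0 < x := hx.1
  have hbd := mul_setIntegral_exp_neg_div_mul_rpow_le ξ ε x hξ hx0 (by
    intro t ht
    have h1 : t * (|2 * ε + 1| + 1) < ξ := (lt_div_iff₀ (by positivity)).1 (ht.2.trans hx.2)
    nlinarith [mul_le_mul_of_nonneg_right (neg_abs_le (2 * ε + 1)) ht.1.le, ht.1])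
  have hnn : 0 ≤ ∫ t in Set.Ioo (0 : ℝ) x, Real.exp (-2 * ξ / t) * t ^ (2 * ε - 1) :=
    setIntegral_nonneg measurableSet_Ioo fun t ht =>
      mul_nonneg (Real.exp_pos _).le (Real.rpow_nonneg ht.1.le _)
  rw [Bsol, Real.norm_eq_abs, abs_mul, abs_mul, abs_mul, abs_neg, Real.abs_exp,
    abs_of_nonneg hnn, abs_of_nonneg (Real.rpow_nonneg hx0.le _)]
  have hcancel : Real.exp (2 * ξ / x) * x ^ (-2 * ε) *
      (Real.exp (-(2 * ξ) / x) * x ^ (2 * ε + 1)) = x := by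
    rw [mul_mul_mul_comm, ← Real.exp_add, ← Real.rpow_add hx0, neg_div, add_neg_cancel,
      Real.exp_zero, one_mul, show -2 * ε + (2 * ε + 1) = 1 by ring, Real.rpow_one]
  rw [← le_div_iff₀' hξ] at hbd
  calc _ ≤ |τ| * Real.exp (2 * ξ / x) * x ^ (-2 * ε) *
        (Real.exp (-(2 * ξ) / x) * x ^ (2 * ε + 1) / ξ) := by gcongr
    _ = |τ| / ξ * (Real.exp (2 * ξ / x) * x ^ (-2 * ε) *
        (Real.exp (-(2 * ξ) / x) * x ^ (2 * ε + 1))) := by ring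
    _ = |τ| / ξ * x := by rw [hcancel]
end
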